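/- arXiv:2104.12800 — 8 statements merged into one kernel-verified Lean document; each statement's English description precedes it below -/
import Mathlib

section
/- Let k ≥ 3, let 1 ≤ t < k, and let x ∈ {0,1}^k be a tuple of Hamming weight d with 1 ≤ d < k and d ≠ t. Suppose it is not the case that t is odd, k is even, and d is odd. Then the template (In_t^k ∪ {x}, NAE) does not have 2-block-symmetric polymorphisms of all odd arities; that is, there exists an odd m ≥ 1 such that no 2-block-symmetric function f : {0,1}^m → {0,1} is a polymorphism of (In_t^k ∪ {x}, NAE). -/
/-- Hamming weight of a Boolean tuple. -/
def wt {k : ℕ} (v : Fin k → Bool) : ℕ :=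
  (Finset.univ.filter (fun i => v i = true)).card

/-- The set of `k`-tuples of Hamming weight exactly `t`. -/
def InT (k t : ℕ) : Set (Fin k → Bool) := {v | wt v = t}

/-- Not-all-equal: all tuples except all-zeros and all-ones. -/
def NAE (k : ℕ) : Set (Fin k → Bool) :=
  {v | v ≠ (fun _ => false) ∧ v ≠ (fun _ => true)}

/-- `f` is a polymorphism of the template `(R, S)`. -/
def IsPolymorphism {k m : ℕ} (R S : Set (Fin k → Bool)) (f : (Fin m → Bool) → Bool) : Prop :=
  ∀ v : Fin m → Fin k → Bool, (∀ j, v j ∈ R) → (fun i => f (fun j => v j i)) ∈ S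

/-- `f` is 2-block-symmetric: invariant under permutations preserving the parity
of coordinate positions. -/
def TwoBlockSym {m : ℕ} (f : (Fin m → Bool) → Bool) : Prop :=
  ∀ π : Equiv.Perm (Fin m), (∀ i, ((π i : ℕ)) % 2 = (i : ℕ) % 2) →
    ∀ x : Fin m → Bool, f (fun i => x (π i)) = f x

open Finset Pointwise in
/-- A two-colouring of `ZMod g` without a monochromatic solution of `a + b + c + n • s = t`
exists only if it is the parity colouring, with `t` odd and `n` odd. -/
theorem odd_of_coloring_avoids {g n t : ℕ} [NeZero g] (χ : ZMod g → Bool)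
    (h : ∀ a b c s : ZMod g, χ a = χ s → χ b = χ s → χ c = χ s →
      a + b + c + n * s ≠ t) : Odd t ∧ Odd n ∧ Even g := by
  let S : Bool → Finset (ZMod g) := fun e => univ.filter (fun a => χ a = e)
  have memS : ∀ e a, a ∈ S e ↔ χ a = e := fun e a => by simp [S]
  have card_le : ∀ e, (S e).Nonempty → (S e + S e).card ≤ (S (!e)).card := by
    rintro e ⟨s, hs⟩
    rw [memS] at hs
    refine card_le_card_of_injOn (fun z => t - n * s - z) ?_ ?_
    · intro z hz
      obtain ⟨a, ha, b, hb, rfl⟩ := mem_add.1 hz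
      rw [memS] at ha hb
      rw [mem_coe, memS]
      by_contra hne
      have hc : χ (t - n * s - (a + b)) = e := by
        revert hne
        cases χ (t - n * s - (a + b)) <;> cases e <;> simp
      exact h a b _ s (ha.trans hs.symm) (hb.trans hs.symm) (hc.trans hs.symm) (by ring)
    · intro z _ z' _ hz
      simpa using hz
  have nonempty : ∀ e, (S e).Nonempty := by
    intro e
    by_contra hne
    rw [not_nonempty_iff_eq_empty] at hne
    have hall : ∀ a, χ a = !e := by
      intro a
      have : a ∉ S e := by simp [hne]
      rw [memS] at this
      revert this
      cases χ a <;> cases e <;> simp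
    exact h t 0 0 0 (by simp [hall]) rfl rfl (by simp)
  have card_self_le : ∀ e, (S e).card ≤ (S e + S e).card := fun e =>
    card_le_card_add_right (nonempty e)
  have card_eq : ∀ e, (S e + S e).card ≤ (S e).card := by
    intro e
    have h1 := card_le e (nonempty e)
    have h2 := card_le (!e) (nonempty _)
    have h3 := card_self_le (!e)
    rw [Bool.not_not] at h2
    omega
  have translate : ∀ e, ∀ s ∈ S e, S e + {s} = S e + S e := by
    intro e s hs
    refine eq_of_subset_of_card_le (add_subset_add_left (singleton_subset_iff.2 hs)) ?_
    rw [card_add_singleton]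
    exact card_eq e
  have alternate : ∀ a, χ (a + 1) = !χ a := by
    intro a
    by_contra hne
    have hsame : χ (a + 1) = χ a := by
      revert hne
      cases χ (a + 1) <;> cases χ a <;> simp
    set e := χ a with he
    have htr := (translate e a ((memS _ _).2 he.symm)).trans
      (translate e (a + 1) ((memS _ _).2 hsame)).symm
    have step : ∀ b, χ b = e → χ (b + 1) = e := by
      intro b hb
      have hm : b + (a + 1) ∈ S e + {a} := by
        rw [htr]
        exact add_mem_add ((memS _ _).2 hb) (mem_singleton_self _)
      obtain ⟨b', hb', a', ha', hsum⟩ := mem_add.1 hm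
      rw [mem_singleton] at ha'
      subst ha'
      have : b' = b + 1 := by linear_combination hsum
      rw [← this]
      exact (memS _ _).1 hb'
    have all : ∀ j : ℕ, χ (a + j) = e := by
      intro j
      induction j with
      | zero => simpa using he.symm
      | succ j ih => simpa [add_assoc] using step _ ih
    obtain ⟨b, hb⟩ := nonempty (!e)
    rw [memS] at hb
    have := all (b - a).val
    rw [ZMod.natCast_zmod_val, add_sub_cancel, hb] at this
    exact absurd this (by cases e <;> simp)
  have add_natCast : ∀ (j : ℕ) a, χ (a + j) = (χ a ^^ decide (Odd j)) := by
    intro j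
    induction j with
    | zero => simp
    | succ j ih =>
      intro a
      rw [Nat.cast_succ, ← add_assoc, alternate, ih]
      by_cases hj : Odd j <;> simp [hj, Nat.odd_add_one]
  have hg : Even g := by
    have := add_natCast g 0
    rw [← Nat.not_odd_iff_even]
    intro ho
    simp [ho] at this
  have ht : Odd t := by
    rw [← Nat.not_even_iff_odd]
    intro hev
    have := add_natCast t 0
    refine h t 0 0 0 ?_ rfl rfl (by simp)
    simpa [Nat.not_odd_iff_even.2 hev] using this
  refine ⟨ht, ?_, hg⟩
  rw [← Nat.not_even_iff_odd]
  intro hn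
  have hn2 : ¬ Odd (n + 2) := by
    rw [Nat.not_odd_iff_even]
    exact hn.add even_two
  have h1 := add_natCast t 0
  have h2 := add_natCast (n + 2) ((t : ZMod g) - (n + 2 : ℕ))
  have h3 := add_natCast 1 0
  rw [sub_add_cancel, decide_eq_false hn2, Bool.xor_false] at h2
  rw [zero_add, decide_eq_true ht] at h1
  rw [zero_add, Nat.cast_one, decide_eq_true odd_one] at h3
  refine h (t - (n + 2 : ℕ)) 1 1 1 ?_ rfl rfl (by push_cast; ring)
  rw [← h2, h1, h3]

open Finset in
/-- A vector `y` with entries at most `#J` and sum `t * #J` is a sum of `#J` Boolean tuples of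
weight `t`. -/
theorem exists_rows_of_column_sums {ι : Type*} [DecidableEq ι] {k t : ℕ} (J : Finset ι)
    (y : Fin k → ℕ) (hy : ∀ i, y i ≤ J.card) (hsum : ∑ i, y i = t * J.card) :
    ∃ v : ι → Fin k → Bool, (∀ j ∈ J, wt (v j) = t) ∧
      ∀ i, (J.filter (fun j => v j i = true)).card = y i := by
  induction J using Finset.induction_on generalizing y with
  | empty => exact ⟨fun _ _ => false, by simp, fun i => by simpa [eq_comm] using hy i⟩
  | insert j J hj ih =>
    rw [card_insert_of_notMem hj] at hy hsum
    have hfull : (univ.filter (fun i => y i = J.card + 1)).card ≤ t := by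
      have h1 : (univ.filter (fun i => y i = J.card + 1)).card * (J.card + 1) ≤ ∑ i, y i := by
        calc _ = ∑ i ∈ univ.filter (fun i => y i = J.card + 1), y i := by
              rw [sum_congr rfl (fun i hi => (mem_filter.1 hi).2), sum_const, smul_eq_mul]
          _ ≤ _ := sum_le_sum_of_subset (filter_subset _ _)
      rw [hsum] at h1
      exact Nat.le_of_mul_le_mul_right h1 (Nat.succ_pos _)
    have hpos : t ≤ (univ.filter (fun i => 0 < y i)).card := by
      have h1 : ∑ i, y i ≤ (univ.filter (fun i => 0 < y i)).card * (J.card + 1) := by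
        calc ∑ i, y i = ∑ i ∈ univ.filter (fun i => 0 < y i), y i := by
              rw [sum_filter]
              exact sum_congr rfl fun i _ => by split_ifs <;> omega
          _ ≤ _ := sum_le_card_nsmul _ _ _ (fun i _ => hy i)
      rw [hsum] at h1
      exact Nat.le_of_mul_le_mul_right h1 (Nat.succ_pos _)
    obtain ⟨T, hT1, hT2, hTc⟩ := exists_subsuperset_card_eq
      (s := univ.filter (fun i => y i = J.card + 1)) (t := univ.filter (fun i => 0 < y i))
      (fun i hi => by simp at hi ⊢; omega) hfull hpos
    have hTpos : ∀ i ∈ T, 0 < y i := fun i hi => (mem_filter.1 (hT2 hi)).2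
    have hTfull : ∀ i, i ∉ T → y i ≤ J.card := by
      intro i hi
      have : y i ≠ J.card + 1 := fun h => hi (hT1 (by simpa using h))
      have := hy i
      omega
    have hsplit : ∀ i, y i = (y i - if i ∈ T then 1 else 0) + if i ∈ T then 1 else 0 := by
      intro i
      split_ifs with hi
      · have := hTpos i hi
        omega
      · rfl
    obtain ⟨v, hv1, hv2⟩ := ih (fun i => y i - if i ∈ T then 1 else 0)
      (fun i => by
        have := hy i
        have := hTfull i
        split_ifs with hi
        · omega
        · simpa using this hi)
      (by
        have h1 : ∑ i, y i = ∑ i, (y i - if i ∈ T then 1 else 0) + T.card := by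
          rw [sum_congr rfl (fun i _ => hsplit i), sum_add_distrib]
          simp
        rw [hsum, hTc, mul_add, mul_one] at h1
        exact (Nat.add_right_cancel h1).symm)
    refine ⟨Function.update v j (fun i => decide (i ∈ T)), ?_, ?_⟩
    · intro j' hj'
      rcases eq_or_ne j' j with rfl | hne
      · simp [wt, hTc]
      · rw [Function.update_of_ne hne]
        exact hv1 j' ((mem_insert.1 hj').resolve_left hne)
    · intro i
      have hcongr : J.filter (fun j' => Function.update v j (fun i => decide (i ∈ T)) j' i = true) =
          J.filter (fun j' => v j' i = true) := by
        refine filter_congr fun j' hj' => ?_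
        rw [Function.update_of_ne (fun h : j' = j => hj (h ▸ hj'))]
      rw [filter_insert, hcongr]
      have hi := hsplit i
      have hvi := hv2 i
      by_cases hiT : i ∈ T
      · simp only [hiT, Function.update_self, decide_true, if_true] at hi hvi ⊢
        rw [card_insert_of_notMem (fun h => hj (mem_filter.1 h).1)]
        omega
      · simp only [hiT, Function.update_self, decide_false, if_false] at hi hvi ⊢
        simpa using hvi

/-- The positions of a given parity. -/
def parityClass (m p : ℕ) : Finset (Fin m) := Finset.univ.filter (fun j => (j : ℕ) % 2 = p)

theorem card_parityClass (L : ℕ) :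
    (parityClass (2 * L + 1) 0).card = L + 1 ∧ (parityClass (2 * L + 1) 1).card = L := by
  simp only [parityClass, Finset.card_filter]
  rw [Fin.sum_univ_eq_sum_range (fun i => if i % 2 = 0 then 1 else 0),
    Fin.sum_univ_eq_sum_range (fun i => if i % 2 = 1 then 1 else 0)]
  induction L with
  | zero => decide
  | succ L ih =>
    rw [show 2 * (L + 1) + 1 = (2 * L + 1) + 1 + 1 by ring]
    simp only [Finset.sum_range_succ _ (2 * L + 1 + 1), Finset.sum_range_succ _ (2 * L + 1), ih]
    have h1 : (2 * L + 1) % 2 = 1 := by omega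
    have h2 : (2 * L + 1 + 1) % 2 = 0 := by omega
    simp [h1, h2]

/-- The number of ones of `y` at the positions of a given parity. -/
def parityCount {m : ℕ} (p : ℕ) (y : Fin m → Bool) : ℕ :=
  ((parityClass m p).filter (fun j => y j = true)).card

theorem card_filter_parity_eq {m : ℕ} (y y' : Fin m → Bool)
    (h0 : parityCount 0 y = parityCount 0 y') (h1 : parityCount 1 y = parityCount 1 y')
    (p : ℕ) (e : Bool) :
    (Finset.univ.filter (fun j : Fin m => ((j : ℕ) % 2, y j) = (p, e))).card =
      (Finset.univ.filter (fun j : Fin m => ((j : ℕ) % 2, y' j) = (p, e))).card := by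
  have hp : parityCount p y = parityCount p y' := by
    rcases p with _ | _ | p
    · exact h0
    · exact h1
    · have : parityClass m (p + 2) = ∅ := by
        refine Finset.filter_eq_empty_iff.2 fun j _ => ?_
        omega
      simp [parityCount, this]
  have key : ∀ z : Fin m → Bool, ∀ e,
      (Finset.univ.filter (fun j : Fin m => ((j : ℕ) % 2, z j) = (p, e))).card =
        ((parityClass m p).filter (fun j => z j = e)).card := by
    intro z e
    rw [parityClass, Finset.filter_filter]
    simp only [Prod.mk.injEq]
  rw [key, key]
  cases e
  · have h := Finset.card_filter_add_card_filter_not (s := parityClass m p) (fun j => y j = true)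
    have h' := Finset.card_filter_add_card_filter_not (s := parityClass m p) (fun j => y' j = true)
    simp only [parityCount] at hp
    simp only [Bool.not_eq_true] at h h'
    omega
  · exact hp

theorem TwoBlockSym.exists_factor {m : ℕ} {f : (Fin m → Bool) → Bool} (hf : TwoBlockSym f) :
    ∃ F : ℕ → ℕ → Bool, ∀ y, f y = F (parityCount 0 y) (parityCount 1 y) := by
  have hfac : f.FactorsThrough (fun y => (parityCount 0 y, parityCount 1 y)) := by
    intro y y' hyy
    rw [Prod.mk.injEq] at hyy
    have hfib : ∀ q : ℕ × Bool, Nonempty ({j : Fin m // ((j : ℕ) % 2, y j) = q} ≃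
        {j : Fin m // ((j : ℕ) % 2, y' j) = q}) := by
      rintro ⟨p, e⟩
      refine ⟨Fintype.equivOfCardEq ?_⟩
      rw [Fintype.card_subtype, Fintype.card_subtype]
      exact card_filter_parity_eq y y' hyy.1 hyy.2 p e
    let π : Equiv.Perm (Fin m) := Equiv.ofFiberEquiv fun q => (hfib q).some
    have hπ : ∀ j, (((π j : Fin m) : ℕ) % 2, y' (π j)) = ((j : ℕ) % 2, y j) := fun j =>
      Equiv.ofFiberEquiv_map (g := fun j : Fin m => ((j : ℕ) % 2, y' j)) _ j
    have hy : (fun j => y' (π j)) = y := funext fun j => congrArg Prod.snd (hπ j)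
    rw [← hf π (fun j => congrArg Prod.fst (hπ j)) y', hy]
  exact ⟨fun a b => Function.extend (fun y => (parityCount 0 y, parityCount 1 y)) f
    (fun _ => false) (a, b), fun y => (hfac.extend_apply _ y).symm⟩

open Finset in
theorem IsPolymorphism.not_monochromatic {k t d N : ℕ} (htk : t ≤ k) {x : Fin k → Bool}
    (hx : wt x = d) {f : (Fin (2 * (k * N) + 1) → Bool) → Bool}
    (hf : IsPolymorphism (InT k t ∪ {x}) (NAE k) f) {F : ℕ → ℕ → Bool}
    (hF : ∀ y, f y = F (parityCount 0 y) (parityCount 1 y)) (a : Fin k → ℕ) (c : ℕ)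
    (hc : c ≤ k * N + 1) (hca : ∀ i, c ≤ a i) (hac : ∀ i, a i + c ≤ k * N + 1)
    (hsum : (∑ i, (a i : ℤ)) = t * (k * N + 1) + (d - t) * c) (e : Bool) :
    ¬ ∀ i, F (a i) (t * N) = e := by
  intro hmono
  obtain ⟨hE, hO⟩ := card_parityClass (k * N)
  set E := parityClass (2 * (k * N) + 1) 0 with hEdef
  set O := parityClass (2 * (k * N) + 1) 1 with hOdef
  have hEO : ∀ j ∈ O, j ∉ E := by
    intro j hj hj'
    have h1 := (mem_filter.1 hj).2
    have h2 := (mem_filter.1 hj').2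
    omega
  have hcov : ∀ j, j ∉ E → j ∈ O := by
    intro j hj
    simp only [hEdef, hOdef, parityClass, mem_filter, mem_univ, true_and] at hj ⊢
    omega
  obtain ⟨C, hCE, hCc⟩ := exists_subset_card_eq (s := E) (n := c) (by omega)
  have hEC : (E \ C).card = k * N + 1 - c := by rw [card_sdiff_of_subset hCE, hE, hCc]
  let y : Fin k → ℕ := fun i => a i - if x i = true then c else 0
  have hya : ∀ i, y i + (if x i = true then c else 0) = a i := by
    intro i
    have := hca i
    simp only [y]
    split_ifs <;> omega
  have hxsum : ∑ i, (if x i = true then c else 0) = d * c := by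
    rw [← sum_filter, sum_const, smul_eq_mul, ← hx, wt]
  have hysum : ∑ i, y i = t * (k * N + 1 - c) := by
    have h1 : ∑ i, y i + d * c = ∑ i, a i := by
      rw [← hxsum, ← sum_add_distrib]
      exact sum_congr rfl fun i _ => hya i
    zify [hc] at h1 ⊢
    rw [hsum] at h1
    linear_combination h1
  obtain ⟨v, hv1, hv2⟩ := exists_rows_of_column_sums (t := t) (E \ C) y
    (fun i => by
      have := hya i
      have := hac i
      omega) (by rw [hysum, hEC])
  obtain ⟨u, hu1, hu2⟩ := exists_rows_of_column_sums (t := t) O (fun _ : Fin k => t * N)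
    (fun _ => by rw [hO]; exact Nat.mul_le_mul_right _ htk)
    (by rw [sum_const, card_univ, Fintype.card_fin, smul_eq_mul, hO]; ring)
  let r : Fin (2 * (k * N) + 1) → Fin k → Bool := fun j =>
    if j ∈ C then x else if j ∈ E then v j else u j
  have hr : ∀ j, r j ∈ InT k t ∪ {x} := by
    intro j
    simp only [r]
    split_ifs with h1 h2
    · exact Or.inr rfl
    · exact Or.inl (hv1 j (mem_sdiff.2 ⟨h2, h1⟩))
    · exact Or.inl (hu1 j (hcov j h2))
  have hcount0 : ∀ i, parityCount 0 (fun j => r j i) = a i := by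
    intro i
    rw [parityCount, ← hEdef, ← sdiff_union_of_subset hCE, filter_union,
      card_union_of_disjoint (disjoint_filter_filter sdiff_disjoint), ← hya i, ← hv2 i]
    congr 1
    · congr 1
      refine filter_congr fun j hj => ?_
      obtain ⟨h1, h2⟩ := mem_sdiff.1 hj
      simp [r, h1, h2]
    · rw [filter_congr (q := fun _ => x i = true) (fun j hj => by simp [r, hj])]
      split_ifs with h <;> simp [h, hCc]
  have hcount1 : ∀ i, parityCount 1 (fun j => r j i) = t * N := by
    intro i
    rw [parityCount, ← hOdef, ← hu2 i]
    congr 1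
    refine filter_congr fun j hj => ?_
    have h2 := hEO j hj
    have h1 : j ∉ C := fun h => h2 (hCE h)
    simp [r, h1, h2]
  have hval : (fun i => f (fun j => r j i)) = fun _ => e := by
    funext i
    rw [hF, hcount0, hcount1, hmono]
  have := hf r hr
  rw [hval] at this
  cases e
  · exact this.1 rfl
  · exact this.2 rfl

/-- The representative of `r` in the window `[w, w + g)`. -/
def windowRep {g : ℕ} (w : ℕ) (r : ZMod g) : ℕ := w + (r - w).val

theorem natCast_windowRep {g : ℕ} [NeZero g] (w : ℕ) (r : ZMod g) :
    ((windowRep w r : ℕ) : ZMod g) = r := by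
  simp [windowRep]

theorem exists_multiplicity {k t d N : ℕ} (htk : t < k) (ht : 1 ≤ t) (hdk : d < k) (hdt : d ≠ t)
    (hN : 4 * k ^ 2 ≤ N) :
    ∃ w, ∀ a : Fin k → ℕ, (∀ i, w ≤ a i ∧ a i < w + ((d : ℤ) - t).natAbs) →
      ((d : ℤ) - t) ∣ (∑ i, (a i : ℤ)) - t * (k * N + 1) →
      ∃ c : ℕ, c ≤ k * N + 1 ∧ (∀ i, c ≤ a i) ∧ (∀ i, a i + c ≤ k * N + 1) ∧
        (∑ i, (a i : ℤ)) = t * (k * N + 1) + (d - t) * c := by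
  have bounds : ∀ (w g : ℕ) (a : Fin k → ℕ), (∀ i, w ≤ a i ∧ a i < w + g) →
      (k : ℤ) * w ≤ ∑ i, (a i : ℤ) ∧ ∑ i, (a i : ℤ) ≤ k * (w + g) := by
    intro w g a ha
    constructor
    · simpa using Finset.card_nsmul_le_sum Finset.univ (fun i => (a i : ℤ)) (w : ℤ)
        (fun i _ => by exact_mod_cast (ha i).1)
    · simpa using Finset.sum_le_card_nsmul Finset.univ (fun i => (a i : ℤ)) ((w : ℤ) + g)
        (fun i _ => by exact_mod_cast (ha i).2.le)
  have hNt : N ≤ t * N := Nat.le_mul_of_pos_left _ ht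
  have hNk : t * N + N ≤ k * N := by nlinarith
  have hkk : k ≤ k ^ 2 := Nat.le_self_pow two_ne_zero k
  suffices h : ∃ w, ∀ a : Fin k → ℕ, (∀ i, w ≤ a i ∧ a i < w + ((d : ℤ) - t).natAbs) →
      ((d : ℤ) - t) ∣ (∑ i, (a i : ℤ)) - t * (k * N + 1) →
      ∃ c : ℕ, c ≤ 2 * k ^ 2 ∧ N ≤ w + k ∧ w ≤ t * N + k ∧
        (∑ i, (a i : ℤ)) = t * (k * N + 1) + (d - t) * c by
    obtain ⟨w, hw⟩ := h
    refine ⟨w, fun a ha hdvd => ?_⟩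
    obtain ⟨c, hc, h1, h2, hs⟩ := hw a ha hdvd
    refine ⟨c, by omega, fun i => ?_, fun i => ?_, hs⟩
    · have := (ha i).1
      omega
    · have := (ha i).2
      omega
  rcases lt_or_gt_of_ne hdt with hlt | hgt
  · obtain ⟨g, rfl⟩ := Nat.exists_eq_add_of_lt hlt
    have hg : ((d : ℤ) - (d + g + 1 : ℕ)) = -(g + 1 : ℕ) := by push_cast; ring
    rw [hg, Int.natAbs_neg, Int.natAbs_natCast]
    refine ⟨(d + g + 1) * N - (g + 1), fun a ha ⟨c, hc⟩ => ?_⟩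
    obtain ⟨h1, h2⟩ := bounds _ _ a ha
    rw [Nat.cast_sub (by omega)] at h1 h2
    push_cast at h1 h2 hc
    have hc0 : 0 ≤ c := by
      by_contra hneg
      push Not at hneg
      nlinarith
    lift c to ℕ using hc0
    refine ⟨c, ?_, by omega, by omega, by push_cast; linarith⟩
    zify
    nlinarith
  · obtain ⟨g, rfl⟩ := Nat.exists_eq_add_of_lt hgt
    have hg : (((t + g + 1 : ℕ) : ℤ) - t) = (g + 1 : ℕ) := by push_cast; ring
    rw [hg, Int.natAbs_natCast]
    refine ⟨t * N + t, fun a ha ⟨c, hc⟩ => ?_⟩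
    obtain ⟨h1, h2⟩ := bounds _ _ a ha
    push_cast at h1 h2 hc
    have hc0 : 0 ≤ c := by
      by_contra hneg
      push Not at hneg
      nlinarith
    lift c to ℕ using hc0
    refine ⟨c, ?_, by omega, by omega, by push_cast; linarith⟩
    zify
    nlinarith

theorem stmt_6 {k t d : ℕ} (hk : 3 ≤ k) (ht : 1 ≤ t) (htk : t < k)
    (hd1 : 1 ≤ d) (hdk : d < k) (hdt : d ≠ t)
    (hpar : ¬(Odd t ∧ Even k ∧ Odd d))
    (x : Fin k → Bool) (hx : wt x = d) :
    ∃ m : ℕ, Odd m ∧ 1 ≤ m ∧ ∀ f : (Fin m → Bool) → Bool,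
      TwoBlockSym f → ¬ IsPolymorphism (InT k t ∪ {x}) (NAE k) f := by
  set g := ((d : ℤ) - t).natAbs with hg
  have hg0 : g ≠ 0 := by omega
  have : NeZero g := ⟨hg0⟩
  set N := g * (4 * k ^ 2) with hN
  obtain ⟨w, hw⟩ := exists_multiplicity htk ht hdk hdt (N := N)
    (Nat.le_mul_of_pos_left _ (Nat.pos_of_ne_zero hg0))
  refine ⟨2 * (k * N) + 1, ⟨k * N, rfl⟩, by omega, fun f hsym hpol => hpar ?_⟩
  obtain ⟨F, hF⟩ := hsym.exists_factor
  obtain ⟨n, rfl⟩ := Nat.exists_eq_add_of_le' hk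
  obtain ⟨h1, h2, h3⟩ := odd_of_coloring_avoids (g := g) (n := n) (t := t)
    (fun r => F (windowRep w r) (t * N)) (by
      intro p q r s hp hq hr hsum
      let z : Fin (n + 3) → ZMod g := Fin.cons p (Fin.cons q (Fin.cons r fun _ => s))
      have hz : ∑ i, z i = t := by
        simp only [z, Fin.sum_univ_succ, Fin.cons_zero, Fin.cons_succ, Finset.sum_const,
          Finset.card_univ, Fintype.card_fin, nsmul_eq_mul]
        rw [← hsum]
        ring
      obtain ⟨c, hc, hca, hac, hcs⟩ := hw (fun i => windowRep w (z i))
        (fun i => ⟨Nat.le_add_right _ _, Nat.add_lt_add_left (ZMod.val_lt _) _⟩) (by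
          rw [← Int.natAbs_dvd, ← hg, ← ZMod.intCast_zmod_eq_zero_iff_dvd]
          push_cast
          simp only [natCast_windowRep, hz, hN]
          simp)
      refine hpol.not_monochromatic htk.le hx hF _ c hc hca hac hcs
        (F (windowRep w s) (t * N)) ?_
      intro i
      refine Fin.cases hp (fun i => Fin.cases hq (fun i => Fin.cases hr (fun i => rfl) i) i) i)
  refine ⟨h1, ?_, ?_⟩
  · rcases h2 with ⟨j, rfl⟩
    exact ⟨j + 2, by ring⟩
  · rcases h1 with ⟨j, rfl⟩
    rw [← Nat.not_even_iff_odd]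
    rw [Nat.even_iff] at *
    omega
end

section
/- Let k ≥ 3, 1 ≤ t < k, and t < d < k be such that d + t ≤ k, and such that t ≡ k (mod 2) or d ≢ t (mod 2). Let x ∈ {0,1}^k be a tuple of Hamming weight d. Then no 2-block-symmetric function f : {0,1}^{2k−1} → {0,1} is a polymorphism of the template (In_t^k ∪ {x}, NAE). -/
/-- `Realizable R n b`: some `n` columns from `R` have row sums `b`. -/
def Realizable {k : ℕ} (R : Set (Fin k → Bool)) (n : ℕ) (b : Fin k → ℕ) : Prop :=
  ∃ v : Fin n → Fin k → Bool, (∀ j, v j ∈ R) ∧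
    ∀ i, (Finset.univ.filter (fun j => v j i = true)).card = b i

lemma Realizable.zero {k : ℕ} (R : Set (Fin k → Bool)) : Realizable R 0 (fun _ => 0) :=
  ⟨fun j => j.elim0, fun j => j.elim0, fun i => by simp⟩

lemma Realizable.cons {k n : ℕ} {R : Set (Fin k → Bool)} {b : Fin k → ℕ}
    (h : Realizable R n b) {x : Fin k → Bool} (hx : x ∈ R) :
    Realizable R (n + 1) (fun i => b i + (x i).toNat) := by
  obtain ⟨v, hv, hb⟩ := h
  refine ⟨Fin.cons x v, fun j => ?_, fun i => ?_⟩
  · refine Fin.cases ?_ (fun j => ?_) j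
    · simpa using hx
    · simpa using hv j
  · dsimp only
    rw [← hb i, Fin.univ_succ, Finset.filter_cons]
    cases hxi : x i <;> simp [hxi, Finset.filter_map]

lemma Realizable.cons_replicate {k n : ℕ} {R : Set (Fin k → Bool)} {b : Fin k → ℕ}
    (h : Realizable R n b) {x : Fin k → Bool} (hx : x ∈ R) (q : ℕ) :
    Realizable R (n + q) (fun i => b i + q * (x i).toNat) := by
  induction q with
  | zero => simpa using h
  | succ q ih =>
    have := ih.cons hx
    simpa only [add_assoc, add_mul, one_mul] using this

lemma Realizable.mono {k n : ℕ} {R R' : Set (Fin k → Bool)} {b : Fin k → ℕ}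
    (h : Realizable R n b) (hR : R ⊆ R') : Realizable R' n b := by
  obtain ⟨v, hv, hb⟩ := h
  exact ⟨v, fun j => hR (hv j), hb⟩

/-- A special case of the Gale–Ryser theorem: all column sums are equal to `t`. -/
lemma realizable_inT {k t : ℕ} (n : ℕ) (b : Fin k → ℕ) (hb : ∀ i, b i ≤ n)
    (hsum : ∑ i, b i = t * n) : Realizable (InT k t) n b := by
  induction n generalizing b with
  | zero =>
    have : b = fun _ => 0 := funext fun i => by simpa using hb i
    rw [this]
    exact Realizable.zero _
  | succ n ih =>
    have hfull : (Finset.univ.filter (fun i => b i = n + 1)).card ≤ t := by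
      have h1 : (Finset.univ.filter (fun i => b i = n + 1)).card * (n + 1) ≤ t * (n + 1) := by
        rw [← hsum, ← smul_eq_mul]
        refine le_trans (Finset.card_nsmul_le_sum _ b (n + 1) fun i hi => ?_)
          (Finset.sum_le_sum_of_subset (Finset.filter_subset _ _))
        exact (Finset.mem_filter.1 hi).2.ge
      exact Nat.le_of_mul_le_mul_right h1 (Nat.succ_pos n)
    have hpos : t ≤ (Finset.univ.filter (fun i => 0 < b i)).card := by
      have h1 : t * (n + 1) ≤ (Finset.univ.filter (fun i => 0 < b i)).card * (n + 1) := by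
        rw [← hsum, ← smul_eq_mul]
        refine le_trans (le_of_eq ?_) (Finset.sum_le_card_nsmul _ b (n + 1) fun i _ => hb i)
        rw [Finset.sum_filter]
        exact Finset.sum_congr rfl fun i _ => by split_ifs <;> omega
      exact Nat.le_of_mul_le_mul_right h1 (Nat.succ_pos n)
    obtain ⟨S, hS1, hS2, hS⟩ := Finset.exists_subsuperset_card_eq
      (s := Finset.univ.filter (fun i => b i = n + 1))
      (t := Finset.univ.filter (fun i => 0 < b i))
      (fun i hi => by simp at hi ⊢; omega) hfull hpos
    have hS1' : ∀ i, b i = n + 1 → i ∈ S := fun i hi => hS1 (by simpa using hi)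
    have hS2' : ∀ i ∈ S, 0 < b i := fun i hi => by simpa using hS2 hi
    have hx : (fun i => decide (i ∈ S)) ∈ InT k t := by simp [InT, wt, hS]
    have hadd : ∀ i, b i - (decide (i ∈ S)).toNat + (decide (i ∈ S)).toNat = b i := by
      intro i
      by_cases hi : i ∈ S
      · have := hS2' i hi
        simp [hi]; omega
      · simp [hi]
    have hcard : ∑ i, (decide (i ∈ S)).toNat = t := by
      rw [← hS, Finset.card_eq_sum_ones, ← Finset.sum_filter_add_sum_filter_not _ (· ∈ S)]
      rw [Finset.sum_congr rfl (g := fun _ => 1) (fun i hi => by simp_all),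
        Finset.sum_congr (s₁ := Finset.univ.filter (¬ · ∈ S)) rfl (g := fun _ => 0)
          (fun i hi => by simp_all)]
      simp
    have hrest := ih (fun i => b i - (decide (i ∈ S)).toNat) (fun i => by
      have h1 := hb i
      by_cases hi : i ∈ S
      · simp [hi]; omega
      · have := mt (hS1' i) hi
        simp [hi]; omega) (by
      have h2 : ∑ i, (b i - (decide (i ∈ S)).toNat) + ∑ i, (decide (i ∈ S)).toNat = ∑ i, b i := by
        rw [← Finset.sum_add_distrib]
        exact Finset.sum_congr rfl fun i _ => hadd i
      rw [hcard, hsum] at h2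
      linarith)
    convert hrest.cons hx using 2 with i
    exact (hadd i).symm

/-- Two Boolean words with equally many ones differ by a permutation. -/
lemma exists_perm_of_card_eq {n : ℕ} (u u' : Fin n → Bool)
    (h : (Finset.univ.filter (fun j => u j = true)).card =
      (Finset.univ.filter (fun j => u' j = true)).card) :
    ∃ σ : Equiv.Perm (Fin n), ∀ j, u' (σ j) = u j := by
  have e : {j // u j = true} ≃ {j // u' j = true} :=
    Fintype.equivOfCardEq (by simpa [Fintype.card_subtype] using h)
  refine ⟨e.extendSubtype, fun j => ?_⟩
  by_cases hj : u j = true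
  · rw [hj]
    exact e.extendSubtype_mem j hj
  · have := e.extendSubtype_not_mem j hj
    simp_all

/-- The positions of a word of length `2k-1`, split into even and odd ones. -/
lemma exists_even_odd_equiv (k : ℕ) (hk : 1 ≤ k) :
    ∃ E : Fin k ⊕ Fin (k - 1) ≃ Fin (2 * k - 1),
      (∀ a, (E (Sum.inl a) : ℕ) % 2 = 0) ∧ ∀ a, (E (Sum.inr a) : ℕ) % 2 = 1 := by
  let g : Fin k ⊕ Fin (k - 1) → Fin (2 * k - 1) :=
    Sum.elim (fun a => ⟨2 * a, by omega⟩) (fun a => ⟨2 * a + 1, by omega⟩)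
  have hg : Function.Bijective g := by
    constructor
    · rintro (a | a) (b | b) h <;> simp [g, Fin.ext_iff] at h ⊢ <;> omega
    · intro j
      rcases Nat.even_or_odd' (j : ℕ) with ⟨c, hc | hc⟩
      · exact ⟨Sum.inl ⟨c, by omega⟩, by simp [g, Fin.ext_iff, hc]⟩
      · exact ⟨Sum.inr ⟨c, by omega⟩, by simp [g, Fin.ext_iff, hc]⟩
  refine ⟨Equiv.ofBijective g hg, fun a => ?_, fun a => ?_⟩
  · simp [g]
  · simp [g]

lemma card_filter_lt {n b : ℕ} (hb : b ≤ n) :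
    (Finset.univ.filter (fun j : Fin n => decide ((j : ℕ) < b) = true)).card = b := by
  simp [Fin.card_filter_val_lt, hb]

/-- A 2-block-symmetric polymorphism colors the row sums of the odd block so that no realizable
row sum vector is monochromatic, once a constant vector is realizable in the even block. -/
lemma exists_coloring {k t : ℕ} (hk : 1 ≤ k) {R : Set (Fin k → Bool)}
    (ht : Realizable R k (fun _ => t)) {f : (Fin (2 * k - 1) → Bool) → Bool}
    (hf : TwoBlockSym f) (hp : IsPolymorphism R (NAE k) f) :
    ∃ h : ℕ → Bool, ∀ b, Realizable R (k - 1) b → ∀ c, ¬ ∀ i, h (b i) = c := by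
  obtain ⟨E, hE0, hE1⟩ := exists_even_odd_equiv k hk
  have key : ∀ (u u' : Fin k → Bool) (w w' : Fin (k - 1) → Bool),
      (Finset.univ.filter (fun j => u j = true)).card =
        (Finset.univ.filter (fun j => u' j = true)).card →
      (Finset.univ.filter (fun j => w j = true)).card =
        (Finset.univ.filter (fun j => w' j = true)).card →
      f (fun j => Sum.elim u w (E.symm j)) = f (fun j => Sum.elim u' w' (E.symm j)) := by
    intro u u' w w' hu hw
    obtain ⟨σ, hσ⟩ := exists_perm_of_card_eq u u' hu
    obtain ⟨τ, hτ⟩ := exists_perm_of_card_eq w w' hw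
    rw [← hf ((E.symm.trans (Equiv.sumCongr σ τ)).trans E) _
      (fun j => Sum.elim u' w' (E.symm j))]
    · congr 1
      funext j
      obtain ⟨a, rfl⟩ := E.surjective j
      rcases a with a | a <;> simp [hσ, hτ]
    · intro j
      obtain ⟨a, rfl⟩ := E.surjective j
      rcases a with a | a <;> simp [hE0, hE1]
  obtain ⟨v, hv, hvt⟩ := ht
  refine ⟨fun b => f (fun j => Sum.elim (fun a : Fin k => decide ((a : ℕ) < t))
    (fun a : Fin (k - 1) => decide ((a : ℕ) < b)) (E.symm j)), ?_⟩
  rintro b ⟨w, hw, hwb⟩ c hc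
  have htk : t ≤ k := by
    refine (hvt ⟨0, hk⟩).ge.trans ?_
    exact (Finset.card_filter_le _ _).trans (by simp)
  have hbk : ∀ i, b i ≤ k - 1 := by
    intro i
    rw [← hwb i]
    exact (Finset.card_filter_le _ _).trans (by simp)
  have hmem := hp (fun j => Sum.elim v w (E.symm j)) (fun j => by
    rcases E.symm j with a | a
    · exact hv a
    · exact hw a)
  have hrow : (fun i => f (fun j => Sum.elim v w (E.symm j) i)) = fun _ => c := by
    funext i
    rw [← hc i]
    have := key (fun a => v a i) (fun a : Fin k => decide ((a : ℕ) < t)) (fun a => w a i)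
      (fun a : Fin (k - 1) => decide ((a : ℕ) < b i))
      (by rw [hvt i, card_filter_lt htk]) (by rw [hwb i, card_filter_lt (hbk i)])
    refine Eq.trans ?_ this
    congr 1
    funext j
    rcases E.symm j with a | a <;> rfl
  rw [hrow] at hmem
  cases c
  · exact hmem.1 rfl
  · exact hmem.2 rfl

lemma sum_toNat_eq_wt {k : ℕ} (x : Fin k → Bool) : ∑ i, (x i).toNat = wt x := by
  rw [wt, Finset.card_filter]
  exact Finset.sum_congr rfl fun i _ => by cases x i <;> rfl

/-- Row sums realized by `q` copies of `x` and `n` columns of weight `t`. -/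
lemma realizable_inT_union {k t : ℕ} (x : Fin k → Bool) (n q : ℕ) (b : Fin k → ℕ)
    (hlow : ∀ i, x i = true → q ≤ b i ∧ b i ≤ n + q) (hhigh : ∀ i, x i = false → b i ≤ n)
    (hsum : ∑ i, b i = t * n + q * wt x) : Realizable (InT k t ∪ {x}) (n + q) b := by
  have hadd : ∀ i, b i - q * (x i).toNat + q * (x i).toNat = b i := by
    intro i
    cases hi : x i
    · simp
    · have := (hlow i hi).1
      simp; omega
  have h1 := realizable_inT (t := t) n (fun i => b i - q * (x i).toNat) (fun i => by
      cases hi : x i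
      · simpa using hhigh i hi
      · have := hlow i hi
        simp; omega) (by
      have h2 : ∑ i, (b i - q * (x i).toNat) + ∑ i, q * (x i).toNat = ∑ i, b i := by
        rw [← Finset.sum_add_distrib]
        exact Finset.sum_congr rfl fun i _ => hadd i
      rw [← Finset.mul_sum, sum_toNat_eq_wt, hsum] at h2
      linarith)
  have h2 := (h1.mono (Set.subset_union_left (t := {x}))).cons_replicate
    (Set.mem_union_right _ rfl : x ∈ InT k t ∪ {x}) q
  convert h2 using 2 with i
  exact (hadd i).symm

lemma sum_ite_mem_eq {k : ℕ} (M : Finset (Fin k)) (r e : ℕ) :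
    ∑ i, (if i ∈ M then r + e else r) = k * r + M.card * e := by
  have : ∀ i, (if i ∈ M then r + e else r) = r + if i ∈ M then e else 0 := fun i => by
    split_ifs <;> rfl
  simp [this, Finset.sum_add_distrib]

/-- A finset of any prescribed size that is comparable with a given one. -/
lemma exists_card_eq_comparable {k : ℕ} (S : Finset (Fin k)) {m : ℕ} (hm : m ≤ k) :
    ∃ M : Finset (Fin k), M.card = m ∧ (m ≤ S.card → M ⊆ S) ∧ (S.card ≤ m → S ⊆ M) := by
  rcases le_total m S.card with h | h
  · obtain ⟨M, hM, hc⟩ := Finset.exists_subset_card_eq h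
    exact ⟨M, hc, fun _ => hM, fun h' =>
      (Finset.eq_of_subset_of_card_le hM (by omega)).ge⟩
  · obtain ⟨M, hM, hc⟩ := Finset.exists_superset_card_eq h (by simpa using hm)
    exact ⟨M, hc, fun h' => (Finset.eq_of_subset_of_card_le hM (by omega)).ge, fun _ => hM⟩

theorem stmt_7 {k t d : ℕ} (hk : 3 ≤ k) (ht : 1 ≤ t) (htk : t < k)
    (htd : t < d) (hdk : d < k) (hsum : d + t ≤ k)
    (hpar : t % 2 = k % 2 ∨ d % 2 ≠ t % 2)
    (x : Fin k → Bool) (hx : wt x = d) :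
    ∀ f : (Fin (2 * k - 1) → Bool) → Bool,
      TwoBlockSym f → ¬ IsPolymorphism (InT k t ∪ {x}) (NAE k) f := by
  intro f hf hp
  have hconst : Realizable (InT k t ∪ {x}) k (fun _ => t) :=
    (realizable_inT k (fun _ => t) (fun _ => htk.le) (by simp [mul_comm])).mono
      Set.subset_union_left
  obtain ⟨h, hh⟩ := exists_coloring (by omega) hconst hf hp
  have two : ∀ (q n r e : ℕ) (M : Finset (Fin k)), n + q = k - 1 →
      (∀ i, x i = true → q ≤ (if i ∈ M then r + e else r) ∧ (if i ∈ M then r + e else r) ≤ n + q) →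
      (∀ i, x i = false → (if i ∈ M then r + e else r) ≤ n) →
      k * r + M.card * e = t * n + q * d → h (r + e) ≠ h r := by
    intro q n r e M hn h1 h2 h3 heq
    refine hh (fun i => if i ∈ M then r + e else r) ?_ (h r) (fun i => ?_)
    · rw [← hn]
      exact realizable_inT_union x n q _ h1 h2 (by rw [sum_ite_mem_eq, h3, hx])
    · split_ifs
      · exact heq
      · rfl
  let S : Finset (Fin k) := Finset.univ.filter (fun i => x i = true)
  have hS : S.card = d := hx
  obtain ⟨s, rfl⟩ : ∃ s, t = s + 1 := ⟨t - 1, by omega⟩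
  have hA : h (s + 1) ≠ h s := by
    obtain ⟨M, hM, -, -⟩ := exists_card_eq_comparable S (m := k - (s + 1)) (by omega)
    refine two 0 (k - 1) s 1 M (by omega) (fun i _ => ?_) (fun i _ => ?_) ?_
    · split_ifs <;> omega
    · split_ifs <;> omega
    · obtain ⟨l, rfl⟩ : ∃ l, k = s + 1 + l := ⟨k - (s + 1), by omega⟩
      have e1 : s + 1 + l - (s + 1) = l := by omega
      have e2 : s + 1 + l - 1 = s + l := by omega
      rw [hM, e1, e2]
      ring
  have hB : h (s + 1 + 1) ≠ h (s + 1) := by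
    obtain ⟨q, e, hqe, hqt, he⟩ : ∃ q e, q * (d - (s + 1)) = s + 1 + e ∧ q ≤ s + 1 ∧ e < d := by
      obtain ⟨c, hc⟩ : ∃ c, d = s + 1 + (c + 1) := ⟨d - (s + 1) - 1, by omega⟩
      have hcd : d - (s + 1) = c + 1 := by omega
      have h1 := Nat.div_add_mod s (c + 1)
      have h2 := Nat.mod_lt s (show 0 < c + 1 by omega)
      have h3 := Nat.div_le_self s (c + 1)
      refine ⟨s / (c + 1) + 1, c - s % (c + 1), ?_, by omega, by omega⟩
      rw [hcd, add_mul, mul_comm (s / (c + 1))]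
      omega
    obtain ⟨M, hM, hMS, -⟩ := exists_card_eq_comparable S (m := e) (by omega)
    have hMS' : ∀ i, x i = false → i ∉ M := fun i hi hiM => by
      have := hMS (by omega) hiM
      simp [S, hi] at this
    refine two q (k - 1 - q) (s + 1) 1 M (by omega) (fun i _ => ?_) (fun i hi => ?_) ?_
    · split_ifs <;> omega
    · rw [if_neg (hMS' i hi)]
      omega
    · rw [hM]
      obtain ⟨l, hl⟩ : ∃ l, k = l + q + 1 := ⟨k - 1 - q, by omega⟩
      obtain ⟨c, hc⟩ : ∃ c, d = s + 1 + c := ⟨d - (s + 1), by omega⟩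
      have e1 : k - 1 - q = l := by omega
      have e2 : d - (s + 1) = c := by omega
      rw [e2] at hqe
      rw [e1, hl, hc]
      linear_combination -hqe
  have hC : h (s + 2) = h s := by
    change h (s + 2) ≠ _ at hB
    revert hA hB
    cases h (s + 2) <;> cases h (s + 1) <;> cases h s <;> simp
  by_cases hkt : (s + 1) % 2 = k % 2
  · obtain ⟨m, hm⟩ : ∃ m, k = s + 1 + 2 * m := ⟨(k - (s + 1)) / 2, by omega⟩
    obtain ⟨M, hM, -, -⟩ := exists_card_eq_comparable S (m := m) (by omega)
    refine two 0 (k - 1) s 2 M (by omega) (fun i _ => ?_) (fun i _ => ?_) ?_ hC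
    · split_ifs <;> omega
    · split_ifs <;> omega
    · have e1 : k - 1 = s + 2 * m := by omega
      rw [hM, e1, hm]
      ring
  · obtain ⟨m, hm⟩ : ∃ m, k + d = 2 * (s + 1) + 2 * m := ⟨(k + d - 2 * (s + 1)) / 2, by omega⟩
    obtain ⟨M, hM, -, hMS⟩ := exists_card_eq_comparable S (m := m) (by omega)
    refine two 1 (k - 2) s 2 M (by omega) (fun i hi => ?_) (fun i _ => ?_) ?_ hC
    · split_ifs with hiM
      · omega
      · have : ¬ d ≤ m := fun hdm => hiM (hMS (by omega) (by simp [S, hi]))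
        omega
    · split_ifs <;> omega
    · obtain ⟨l, hl⟩ : ∃ l, k = l + 2 := ⟨k - 2, by omega⟩
      have e1 : k - 2 = l := by omega
      rw [hM, e1]
      rw [hl] at hm ⊢
      linear_combination -hm
end

section
/- Let k ≥ 3, 1 < t < k, and 1 ≤ d < t be such that d + t ≤ k, and such that t ≡ k (mod 2) or d ≢ t (mod 2). Let x ∈ {0,1}^k be a tuple of Hamming weight d. Then no 2-block-symmetric function f : {0,1}^{2k+1} → {0,1} is a polymorphism of the template (In_t^k ∪ {x}, NAE). -/
/-- `p` is the vector of column sums of some `n`-row matrix whose rows lie in `R`. -/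
def IsColSum {k : ℕ} (R : Set (Fin k → Bool)) (n : ℕ) (p : Fin k → ℕ) : Prop :=
  ∃ M : ℕ → Fin k → Bool, (∀ j < n, M j ∈ R) ∧
    ∀ i, ((Finset.range n).filter (fun j => M j i = true)).card = p i

theorem IsColSum.succ {k n : ℕ} {R : Set (Fin k → Bool)} {p : Fin k → ℕ}
    (h : IsColSum R n p) {v : Fin k → Bool} (hv : v ∈ R) :
    IsColSum R (n + 1) (fun i => p i + if v i = true then 1 else 0) := by
  obtain ⟨M, hM, hp⟩ := h
  refine ⟨fun j => if j = n then v else M j, fun j hj => ?_, fun i => ?_⟩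
  · by_cases hjn : j = n
    · simpa [hjn] using hv
    · simpa [hjn] using hM j (by omega)
  · have hcongr : (Finset.range n).filter (fun j => (if j = n then v else M j) i = true)
        = (Finset.range n).filter (fun j => M j i = true) := by
      refine Finset.filter_congr fun j hj => ?_
      rw [if_neg (Finset.mem_range.1 hj).ne]
    rw [Finset.range_add_one, Finset.filter_insert, hcongr]
    dsimp only
    rw [← hp i]
    by_cases hvi : v i = true <;> simp [hvi]

theorem IsColSum.add_mul {k n : ℕ} {R : Set (Fin k → Bool)} {p : Fin k → ℕ}
    (h : IsColSum R n p) {v : Fin k → Bool} (hv : v ∈ R) (s : ℕ) :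
    IsColSum R (n + s) (fun i => p i + if v i = true then s else 0) := by
  induction s with
  | zero => simpa using h
  | succ s ih =>
    rw [← add_assoc]
    convert ih.succ hv using 2 with i
    split_ifs <;> omega

theorem IsColSum.mono {k n : ℕ} {R S : Set (Fin k → Bool)} {p : Fin k → ℕ}
    (h : IsColSum R n p) (hRS : R ⊆ S) : IsColSum S n p := by
  obtain ⟨M, hM, hp⟩ := h
  exact ⟨M, fun j hj => hRS (hM j hj), hp⟩

/-- Any vector with entries at most `n` and total `t * n` is the vector of column sums of
`n` tuples of weight `t`. -/
theorem isColSum_InT {k t : ℕ} (n : ℕ) (p : Fin k → ℕ) (hp : ∀ i, p i ≤ n)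
    (hsum : ∑ i, p i = t * n) : IsColSum (InT k t) n p := by
  induction n generalizing p with
  | zero => exact ⟨fun _ _ => false, by simp, fun i => by simpa using (Nat.le_zero.1 (hp i)).symm⟩
  | succ n ih =>
    set A := Finset.univ.filter (fun i => p i = n + 1) with hA
    set B := Finset.univ.filter (fun i => 0 < p i) with hB
    have hAB : A ⊆ B := fun i hi => by
      simp only [hA, hB, Finset.mem_filter, Finset.mem_univ, true_and] at hi ⊢
      omega
    have hAt : A.card ≤ t := by
      have h1 : A.card * (n + 1) ≤ t * (n + 1) := by
        rw [← hsum, ← smul_eq_mul, ← Finset.sum_const]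
        calc ∑ _i ∈ A, (n + 1) = ∑ i ∈ A, p i :=
              Finset.sum_congr rfl fun i hi => ((Finset.mem_filter.1 hi).2).symm
          _ ≤ ∑ i, p i := Finset.sum_le_sum_of_subset (Finset.subset_univ _)
      exact Nat.le_of_mul_le_mul_right h1 (Nat.succ_pos n)
    have hBt : t ≤ B.card := by
      have h1 : t * (n + 1) ≤ B.card * (n + 1) := by
        rw [← hsum, ← smul_eq_mul (a := B.card), ← Finset.sum_const, hB, Finset.sum_filter]
        refine Finset.sum_le_sum fun i _ => ?_
        have := hp i
        split_ifs <;> omega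
      exact Nat.le_of_mul_le_mul_right h1 (Nat.succ_pos n)
    obtain ⟨S, hAS, hSB, hS⟩ := Finset.exists_subsuperset_card_eq hAB hAt hBt
    have hpos : ∀ i ∈ S, 0 < p i := fun i hi => (Finset.mem_filter.1 (hSB hi)).2
    have hfull : ∀ i, i ∉ S → p i ≤ n := fun i hi => by
      have h1 : p i ≠ n + 1 := fun h => hi (hAS (by simp [hA, h]))
      have := hp i
      omega
    have hsplit : ∀ i, p i = (p i - if i ∈ S then 1 else 0) + if i ∈ S then 1 else 0 := by
      intro i
      by_cases hi : i ∈ S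
      · have := hpos i hi
        simp only [hi, if_true]
        omega
      · simp [hi]
    have hrec := ih (fun i => p i - if i ∈ S then 1 else 0)
      (fun i => by
        by_cases hi : i ∈ S
        · have := hp i
          simp only [hi, if_true]
          omega
        · simpa [hi] using hfull i hi)
      (by
        have h1 : ∑ i, p i = ∑ i, (p i - if i ∈ S then 1 else 0) + S.card := by
          conv_lhs => rw [Finset.sum_congr rfl fun i _ => hsplit i]
          rw [Finset.sum_add_distrib]
          simp
        rw [hsum, hS, mul_add, mul_one] at h1
        omega)
    have hv : (fun i => decide (i ∈ S)) ∈ InT k t := by simp [InT, wt, hS]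
    convert hrec.succ hv using 2 with i
    simpa using hsplit i

/-- Two-valued column sums of `n` rows, of which `s` are copies of `x` and the others have
weight `t`. -/
theorem isColSum_two_valued {k t d : ℕ} {x : Fin k → Bool} (hx : wt x = d)
    (n s c α β : ℕ) (hc : c ≤ k) (hsα : s ≤ α) (hsβ : s ≤ β) (hα : α + s ≤ n)
    (hβ : β + s ≤ n) (hsum : c * α + (k - c) * β + s * t = t * n + s * d) :
    ∃ S : Finset (Fin k), IsColSum (InT k t ∪ {x}) n (fun i => if i ∈ S then α else β) := by
  obtain ⟨S, -, hS⟩ := Finset.exists_subset_card_eq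
    (s := (Finset.univ : Finset (Fin k))) (n := c) (by simpa using hc)
  refine ⟨S, ?_⟩
  have hsplit : ∀ i, (if i ∈ S then α else β) =
      ((if i ∈ S then α else β) - if x i = true then s else 0) + if x i = true then s else 0 := by
    intro i
    split_ifs <;> omega
  have htot : ∑ i, (if i ∈ S then α else β) = c * α + (k - c) * β := by
    rw [Finset.sum_ite]
    simp [hS, Finset.filter_not, ← Finset.compl_eq_univ_sdiff, Finset.card_compl]
  have hxs : ∑ i, (if x i = true then s else 0) = d * s := by
    rw [← Finset.sum_filter, Finset.sum_const, smul_eq_mul]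
    exact congrArg (· * s) hx
  have hbase := isColSum_InT (t := t) (n - s)
    (fun i => (if i ∈ S then α else β) - if x i = true then s else 0)
    (fun i => by split_ifs <;> omega)
    (by
      have h1 : ∑ i, (if i ∈ S then α else β) = _ :=
        Finset.sum_congr rfl fun i _ => hsplit i
      rw [Finset.sum_add_distrib, htot, hxs] at h1
      obtain ⟨m, rfl⟩ : ∃ m, n = m + s := ⟨n - s, by omega⟩
      rw [Nat.add_sub_cancel]
      nlinarith)
  have hfin := (hbase.mono (S := InT k t ∪ {x}) Set.subset_union_left).add_mul
    (v := x) (Or.inr rfl) s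
  rw [Nat.sub_add_cancel (by omega)] at hfin
  convert hfin using 2 with i
  exact hsplit i

/-- A pair consisting of the weights of a tuple on even and on odd positions. -/
def blockWt {m : ℕ} (u : Fin m → Bool) : ℕ × ℕ :=
  ((Finset.univ.filter (fun j : Fin m => (j : ℕ) % 2 = 0 ∧ u j = true)).card,
   (Finset.univ.filter (fun j : Fin m => (j : ℕ) % 2 = 1 ∧ u j = true)).card)

theorem exists_perm_comp_eq_of_card_fiber_eq {α β : Type*} [Fintype α] [DecidableEq β]
    (f g : α → β)
    (h : ∀ b, (Finset.univ.filter (fun a => f a = b)).card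
      = (Finset.univ.filter (fun a => g a = b)).card) :
    ∃ π : Equiv.Perm α, ∀ a, g (π a) = f a := by
  have e : ∀ b, {a // f a = b} ≃ {a // g a = b} := fun b =>
    Fintype.equivOfCardEq (by simpa [Fintype.card_subtype] using h b)
  refine ⟨(Equiv.sigmaFiberEquiv f).symm.trans
    ((Equiv.sigmaCongrRight e).trans (Equiv.sigmaFiberEquiv g)), fun a => ?_⟩
  exact (e (f a) ⟨a, rfl⟩).2

theorem TwoBlockSym.factorsThrough_blockWt {m : ℕ} {f : (Fin m → Bool) → Bool}
    (hf : TwoBlockSym f) : Function.FactorsThrough f blockWt := by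
  intro u w huw
  have hcount : ∀ (y : Fin m → Bool) (r : ℕ),
      (Finset.univ.filter (fun j : Fin m => (j : ℕ) % 2 = r ∧ y j = true)).card
      + (Finset.univ.filter (fun j : Fin m => (j : ℕ) % 2 = r ∧ y j = false)).card
      = (Finset.univ.filter (fun j : Fin m => (j : ℕ) % 2 = r)).card := by
    intro y r
    rw [← Finset.card_filter_add_card_filter_not (s := Finset.univ.filter
      (fun j : Fin m => (j : ℕ) % 2 = r)) (fun j => y j = true)]
    simp [Finset.filter_filter]
  have htrue : ∀ r,
      (Finset.univ.filter (fun j : Fin m => (j : ℕ) % 2 = r ∧ u j = true)).card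
      = (Finset.univ.filter (fun j : Fin m => (j : ℕ) % 2 = r ∧ w j = true)).card := by
    intro r
    rcases lt_trichotomy r 1 with hr | rfl | hr
    · obtain rfl : r = 0 := by omega
      exact congrArg Prod.fst huw
    · exact congrArg Prod.snd huw
    · have : ∀ (j : Fin m), (j : ℕ) % 2 ≠ r := fun j => by omega
      simp [this]
  obtain ⟨π, hπ⟩ := exists_perm_comp_eq_of_card_fiber_eq
    (fun j : Fin m => ((j : ℕ) % 2, u j)) (fun j : Fin m => ((j : ℕ) % 2, w j))
    (by
      rintro ⟨r, b⟩
      simp only [Prod.mk.injEq]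
      cases b
      · have h1 := hcount u r
        have h2 := hcount w r
        have h3 := htrue r
        omega
      · exact htrue r)
  have hw := hf π (fun i => congrArg Prod.fst (hπ i)) w
  rw [← hw]
  exact congrArg f (funext fun i => (congrArg Prod.snd (hπ i)).symm)

theorem card_filter_even_positions (k : ℕ) (p : ℕ → Prop) [DecidablePred p] :
    (Finset.univ.filter (fun j : Fin (2 * k + 1) => (j : ℕ) % 2 = 0 ∧ p (j / 2))).card
      = ((Finset.range (k + 1)).filter p).card := by
  refine Finset.card_bij' (fun j _ => (j : ℕ) / 2) (fun a ha => ⟨2 * a, ?_⟩) ?_ ?_ ?_ ?_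
  · have := Finset.mem_range.1 (Finset.mem_filter.1 ha).1
    omega
  · intro j hj
    simp only [Finset.mem_filter, Finset.mem_univ, true_and, Finset.mem_range] at hj ⊢
    exact ⟨by omega, hj.2⟩
  · intro a ha
    simpa using (Finset.mem_filter.1 ha).2
  · intro j hj
    simp only [Finset.mem_filter, Finset.mem_univ, true_and] at hj
    ext
    dsimp only
    omega
  · intro a ha
    simp

theorem card_filter_odd_positions (k : ℕ) (p : ℕ → Prop) [DecidablePred p] :
    (Finset.univ.filter (fun j : Fin (2 * k + 1) => (j : ℕ) % 2 = 1 ∧ p (j / 2))).card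
      = ((Finset.range k).filter p).card := by
  refine Finset.card_bij' (fun j _ => (j : ℕ) / 2) (fun a ha => ⟨2 * a + 1, ?_⟩) ?_ ?_ ?_ ?_
  · have := Finset.mem_range.1 (Finset.mem_filter.1 ha).1
    omega
  · intro j hj
    simp only [Finset.mem_filter, Finset.mem_univ, true_and, Finset.mem_range] at hj ⊢
    exact ⟨by omega, hj.2⟩
  · intro a ha
    have h1 : (2 * a + 1) / 2 = a := by omega
    have h2 : (2 * a + 1) % 2 = 1 := by omega
    simpa [h1, h2] using (Finset.mem_filter.1 ha).2
  · intro j hj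
    simp only [Finset.mem_filter, Finset.mem_univ, true_and] at hj
    ext
    dsimp only
    omega
  · intro a ha
    dsimp only
    omega

/-- A polymorphism depending only on block weights is not constant on the columns of a pair of
matrices with rows in `R`. -/
theorem IsPolymorphism.not_const_of_isColSum {k : ℕ} {R : Set (Fin k → Bool)}
    {f : (Fin (2 * k + 1) → Bool) → Bool} (hf : IsPolymorphism R (NAE k) f)
    {G : ℕ × ℕ → Bool} (hG : f = G ∘ blockWt) {p q : Fin k → ℕ}
    (hp : IsColSum R (k + 1) p) (hq : IsColSum R k q) (b : Bool) :
    ¬ ∀ i, G (p i, q i) = b := by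
  intro hconst
  obtain ⟨M, hM, hMp⟩ := hp
  obtain ⟨N, hN, hNq⟩ := hq
  have hnae := hf (fun j => if (j : ℕ) % 2 = 0 then M (j / 2) else N (j / 2)) (fun j => by
    split_ifs with hj
    · exact hM _ (by omega)
    · exact hN _ (by omega))
  have hval : (fun i => f fun j : Fin (2 * k + 1) =>
      (if (j : ℕ) % 2 = 0 then M (j / 2) else N (j / 2)) i) = fun _ => b := by
    funext i
    rw [hG, Function.comp_apply, ← hconst i]
    congr 1
    refine Prod.ext ?_ ?_
    · rw [← hMp i, ← card_filter_even_positions k (fun j => M j i = true)]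
      dsimp only [blockWt]
      refine congrArg Finset.card (Finset.filter_congr fun j _ => ?_)
      refine and_congr_right fun hj => ?_
      rw [if_pos hj]
    · rw [← hNq i, ← card_filter_odd_positions k (fun j => N j i = true)]
      dsimp only [blockWt]
      refine congrArg Finset.card (Finset.filter_congr fun j _ => ?_)
      refine and_congr_right fun hj => ?_
      rw [if_neg (by omega)]
  rw [hval] at hnae
  cases b
  · exact hnae.1 rfl
  · exact hnae.2 rfl

theorem stmt_8 {k t d : ℕ} (hk : 3 ≤ k) (ht : 1 < t) (htk : t < k)
    (hd1 : 1 ≤ d) (hdt : d < t) (hsum : d + t ≤ k)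
    (hpar : t % 2 = k % 2 ∨ d % 2 ≠ t % 2)
    (x : Fin k → Bool) (hx : wt x = d) :
    ∀ f : (Fin (2 * k + 1) → Bool) → Bool,
      TwoBlockSym f → ¬ IsPolymorphism (InT k t ∪ {x}) (NAE k) f := by
  intro f hsym hpol
  obtain ⟨G, hG⟩ := (Function.factorsThrough_iff f).1 hsym.factorsThrough_blockWt
  have hodd : IsColSum (InT k t ∪ {x}) k (fun _ => t) :=
    (isColSum_InT k (fun _ => t) (fun _ => htk.le) (by simp [mul_comm])).mono
      Set.subset_union_left
  have key : ∀ s c α β : ℕ, c ≤ k → s ≤ α → s ≤ β → α + s ≤ k + 1 → β + s ≤ k + 1 →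
      c * α + (k - c) * β + s * t = t * (k + 1) + s * d → G (α, t) ≠ G (β, t) := by
    intro s c α β hc hsα hsβ hα hβ hs heq
    obtain ⟨S, hS⟩ := isColSum_two_valued hx (k + 1) s c α β hc hsα hsβ hα hβ hs
    refine hpol.not_const_of_isColSum hG hS hodd (G (β, t)) fun i => ?_
    split_ifs
    · exact heq
    · rfl
  have h01 : G (t + 1, t) ≠ G (t, t) := by
    refine key 0 t (t + 1) t htk.le (by omega) (by omega) (by omega) (by omega) ?_
    obtain ⟨l, rfl⟩ : ∃ l, k = t + l := ⟨k - t, by omega⟩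
    rw [Nat.add_sub_cancel_left]
    ring
  obtain ⟨r, rfl⟩ : ∃ r, t = r + 1 := ⟨t - 1, by omega⟩
  have h11 : G (r + 1 + 1, r + 1) ≠ G (r, r + 1) := by
    by_cases hkt : (r + 1) % 2 = k % 2
    · obtain ⟨l, rfl⟩ : ∃ l, k = r + 1 + 2 * l := ⟨(k - (r + 1)) / 2, by omega⟩
      refine key 0 (r + 1 + l) (r + 1 + 1) r (by omega) (by omega) (by omega) (by omega)
        (by omega) ?_
      rw [show r + 1 + 2 * l - (r + 1 + l) = l by omega]
      ring
    · obtain ⟨l, rfl⟩ : ∃ l, k = d + 2 * l := ⟨(k - d) / 2, by omega⟩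
      refine key 1 (d + l) (r + 1 + 1) r (by omega) (by omega) (by omega) (by omega)
        (by omega) ?_
      rw [show d + 2 * l - (d + l) = l by omega]
      ring
  have hm : G (r, r + 1) = G (r + 1, r + 1) := by
    revert h01 h11
    cases G (r + 1 + 1, r + 1) <;> cases G (r, r + 1) <;> cases G (r + 1, r + 1) <;> simp
  obtain ⟨D, hD⟩ : ∃ D, r + 1 = d + D := ⟨r + 1 - d, by omega⟩
  have hDpos : 0 < D := by omega
  obtain ⟨s, hs1, hs2⟩ : ∃ s, r + 1 ≤ s * D ∧ s * D < r + 1 + D := by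
    refine ⟨(r + D) / D, ?_, ?_⟩
    · have := Nat.lt_div_mul_add (a := r + D) hDpos
      omega
    · have := Nat.div_mul_le_self (r + D) D
      omega
  have hsd : s ≤ d + 1 := by
    by_contra hcon
    have h1 : (d + 2) * D ≤ s * D := Nat.mul_le_mul_right D (by omega)
    have h2 : d ≤ d * D := Nat.le_mul_of_pos_right d hDpos
    have h3 : (d + 2) * D = d * D + 2 * D := by ring
    omega
  obtain ⟨c, hc⟩ : ∃ c, s * D = r + 1 + c := ⟨s * D - (r + 1), by omega⟩
  have hst : s * (r + 1) = s * d + s * D := by rw [hD, mul_add]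
  by_cases hc0 : c = 0
  · refine key s 0 (r + 1) (r + 1) (by omega) (by omega) (by omega) (by omega) (by omega) ?_ rfl
    rw [hst, hc, hc0, Nat.sub_zero]
    ring
  · have hsr : s ≤ r := by
      by_contra hcon
      have h1 : D = 1 := by omega
      subst h1
      omega
    refine key s c r (r + 1) (by omega) hsr (by omega) (by omega) (by omega) ?_ hm
    obtain ⟨l, rfl⟩ : ∃ l, k = c + l := ⟨k - c, by omega⟩
    rw [hst, hc, Nat.add_sub_cancel_left]
    ring
end

section
/- Let k ≥ 3 be odd, let 1 < t < k with t even, and let 1 ≤ d < t with d even and t + d ≤ k. Let x ∈ {0,1}^k be a tuple of Hamming weight d. Then the template (In_t^k ∪ {x}, NAE) does not have 2-block-symmetric polymorphisms of all odd arities; that is, there exists an odd m ≥ 1 such that no 2-block-symmetric function f : {0,1}^m → {0,1} is a polymorphism of (In_t^k ∪ {x}, NAE). -/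
open Finset in
/-- Any column sums `r i ≤ n` with total `t * n` are realised by `n` rows of weight `t`. -/
theorem exists_rows_of_column_sums_s10 {k t : ℕ} (n : ℕ) (r : Fin k → ℕ) (hr : ∀ i, r i ≤ n)
    (hsum : ∑ i, r i = t * n) (htk : t ≤ k) :
    ∃ A : ℕ → Fin k → Bool, (∀ l, wt (A l) = t) ∧
      ∀ i, ∑ l ∈ range n, (if A l i = true then 1 else 0) = r i := by
  have of_finset : ∀ T : Finset (Fin k), wt (fun i => decide (i ∈ T)) = #T := by
    intro T
    simp [wt]
  induction n generalizing r with
  | zero =>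
    obtain ⟨T, -, hT⟩ := exists_subset_card_eq (s := (univ : Finset (Fin k))) (n := t) (by simpa)
    refine ⟨fun _ i => decide (i ∈ T), fun _ => by rw [of_finset, hT], fun i => ?_⟩
    have := hr i
    simp only [range_zero, sum_empty]
    omega
  | succ n ih =>
    have hlow : #{i | r i = n + 1} ≤ t := by
      have h : ∑ i with r i = n + 1, (n + 1) ≤ ∑ i, r i := by
        rw [← sum_congr rfl (fun i hi => (mem_filter.1 hi).2)]
        exact sum_le_sum_of_subset (filter_subset _ _)
      rw [sum_const, smul_eq_mul, hsum] at h
      exact Nat.le_of_mul_le_mul_right h (Nat.succ_pos n)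
    have hhigh : t ≤ #{i | 1 ≤ r i} := by
      have h : ∑ i, r i ≤ ∑ i with 1 ≤ r i, (n + 1) := by
        rw [sum_filter]
        refine sum_le_sum fun i _ => ?_
        have := hr i
        split_ifs <;> omega
      rw [sum_const, smul_eq_mul, hsum] at h
      exact Nat.le_of_mul_le_mul_right h (Nat.succ_pos n)
    have hsub : ({i | r i = n + 1} : Finset (Fin k)) ⊆ ({i | 1 ≤ r i} : Finset (Fin k)) := by
      intro i
      simp only [mem_filter, mem_univ, true_and]
      omega
    obtain ⟨T, hT1, hT2, hT⟩ := exists_subsuperset_card_eq hsub hlow hhigh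
    have hpos : ∀ i ∈ T, 1 ≤ r i := fun i hi => (mem_filter.1 (hT2 hi)).2
    have hdecomp : ∀ i, r i - (if i ∈ T then 1 else 0) + (if i ∈ T then 1 else 0) = r i := by
      intro i
      split_ifs with h
      · have := hpos i h
        omega
      · rfl
    obtain ⟨A, hA, hcol⟩ := ih (fun i => r i - if i ∈ T then 1 else 0) (by
      intro i
      have := hr i
      by_cases h : i ∈ T
      · simp only [h, if_true]
        omega
      · have : r i ≠ n + 1 := fun h' => h (hT1 (by simpa using h'))
        simp only [h, if_false]
        omega) (by
      have h := sum_congr rfl (fun i (_ : i ∈ univ) => hdecomp i)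
      rw [sum_add_distrib, hsum] at h
      simp only [sum_ite_mem, univ_inter, sum_const, smul_eq_mul, mul_one, hT] at h
      rw [mul_add] at h
      omega)
    refine ⟨fun l => if l < n then A l else fun i => decide (i ∈ T), fun l => ?_, fun i => ?_⟩
    · dsimp only
      split_ifs
      · exact hA l
      · rw [of_finset, hT]
    · rw [sum_range_succ, ← hdecomp i, ← hcol i]
      congr 1
      · refine sum_congr rfl fun l hl => ?_
        simp [mem_range.1 hl]
      · simp

open Finset in
/-- A 2-block-symmetric function depends only on the number of ones in each block. -/
theorem TwoBlockSym.eq_of_counts {m : ℕ} {f : (Fin m → Bool) → Bool} (hf : TwoBlockSym f)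
    (y z : Fin m → Bool)
    (h : ∀ c : ℕ, #{i : Fin m | y i = true ∧ (i : ℕ) % 2 = c} =
      #{i : Fin m | z i = true ∧ (i : ℕ) % 2 = c}) : f y = f z := by
  have hcount : ∀ w : Fin m → Bool, ∀ c : ℕ,
      #{i : Fin m | w i = true ∧ (i : ℕ) % 2 = c} + #{i : Fin m | w i = false ∧ (i : ℕ) % 2 = c}
        = #{i : Fin m | (i : ℕ) % 2 = c} := by
    intro w c
    rw [← card_filter_add_card_filter_not (s := {i : Fin m | (i : ℕ) % 2 = c})
      (fun i => w i = true), filter_filter, filter_filter]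
    simp [and_comm]
  have hcard : ∀ p : Bool × ℕ,
      Nonempty ({i : Fin m // (y i, (i : ℕ) % 2) = p} ≃ {i : Fin m // (z i, (i : ℕ) % 2) = p}) := by
    rintro ⟨b, c⟩
    refine ⟨Fintype.equivOfCardEq ?_⟩
    rw [Fintype.card_subtype, Fintype.card_subtype]
    simp only [Prod.mk.injEq]
    have h1 := hcount y c
    have h2 := hcount z c
    have h3 := h c
    cases b <;> omega
  let π : Equiv.Perm (Fin m) := Equiv.ofFiberEquiv fun p => (hcard p).some
  have hπ : ∀ i, (z (π i), ((π i : Fin m) : ℕ) % 2) = (y i, (i : ℕ) % 2) := fun i =>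
    Equiv.ofFiberEquiv_map (f := fun i : Fin m => (y i, (i : ℕ) % 2))
      (g := fun i : Fin m => (z i, (i : ℕ) % 2)) (fun p => (hcard p).some) i
  rw [← hf π (fun i => (Prod.mk.inj (hπ i)).2) z]
  congr 1
  funext i
  exact ((Prod.mk.inj (hπ i)).1).symm

/-- The tuple whose even-indexed entries are listed by `p` and odd-indexed entries by `q`. -/
def interleave (M : ℕ) (p q : ℕ → Bool) : Fin (2 * M + 1) → Bool :=
  fun i => if (i : ℕ) % 2 = 0 then p (i / 2) else q (i / 2)

open Finset in
theorem sum_range_interleave (M : ℕ) (g : ℕ → ℕ) :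
    ∑ i ∈ range (2 * M + 1), g i =
      ∑ l ∈ range (M + 1), g (2 * l) + ∑ l ∈ range M, g (2 * l + 1) := by
  induction M with
  | zero => simp
  | succ M ih =>
    rw [show 2 * (M + 1) + 1 = 2 * M + 1 + 1 + 1 by ring, sum_range_succ, sum_range_succ, ih,
      sum_range_succ _ (M + 1),
      sum_range_succ (fun l => g (2 * l + 1)) M, show 2 * (M + 1) = 2 * M + 1 + 1 by ring]
    ring

open Finset in
theorem card_interleave (M : ℕ) (p q : ℕ → Bool) (c : ℕ) :
    #{i : Fin (2 * M + 1) | interleave M p q i = true ∧ (i : ℕ) % 2 = c} =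
      (if c = 0 then ∑ l ∈ range (M + 1), (if p l = true then 1 else 0) else 0) +
      (if c = 1 then ∑ l ∈ range M, (if q l = true then 1 else 0) else 0) := by
  rw [card_filter]
  rw [sum_congr rfl (g := fun i : Fin (2 * M + 1) =>
    if (if (i : ℕ) % 2 = 0 then p (i / 2) else q (i / 2)) = true ∧ (i : ℕ) % 2 = c then 1 else 0)
    (fun i _ => by simp only [interleave]; congr), Fin.sum_univ_eq_sum_range (fun i => if (if i % 2 = 0 then p (i / 2) else q (i / 2)) = true ∧
    i % 2 = c then 1 else 0), sum_range_interleave]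
  congr 1
  · split_ifs with h
    · refine sum_congr rfl fun l _ => ?_
      simp [h]
    · refine sum_eq_zero fun l _ => ?_
      simp [Ne.symm h]
  · have h1 : ∀ l, (2 * l + 1) % 2 = 1 := by omega
    have h2 : ∀ l, (2 * l + 1) / 2 = l := by omega
    split_ifs with h
    · refine sum_congr rfl fun l _ => ?_
      simp [h, h1, h2]
    · refine sum_eq_zero fun l _ => ?_
      simp [Ne.symm h, h1]

open Finset in
theorem TwoBlockSym.interleave_congr {M : ℕ} {f : (Fin (2 * M + 1) → Bool) → Bool}
    (hf : TwoBlockSym f) (p q p' q' : ℕ → Bool)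
    (hp : ∑ l ∈ range (M + 1), (if p l = true then 1 else 0) =
      ∑ l ∈ range (M + 1), (if p' l = true then 1 else 0))
    (hq : ∑ l ∈ range M, (if q l = true then 1 else 0) =
      ∑ l ∈ range M, (if q' l = true then 1 else 0)) :
    f (interleave M p q) = f (interleave M p' q') :=
  hf.eq_of_counts _ _ fun c => by rw [card_interleave, card_interleave, hp, hq]

open Finset in
theorem sum_range_decide_lt {n a : ℕ} (h : a ≤ n) :
    ∑ l ∈ range n, (if decide (l < a) = true then 1 else 0) = a := by
  simp only [decide_eq_true_eq]
  rw [← card_filter, show (range n).filter (· < a) = range a by ext; simp; omega, card_range]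

/-- A multiple of `D` lies within distance `D` above any `n`. -/
theorem exists_mul_eq_add (D n : ℕ) (hD : 0 < D) : ∃ s j, D * s = n + j ∧ j ≤ D ∧ s ≤ n + 1 := by
  refine ⟨n / D + 1, D - n % D, ?_, Nat.sub_le _ _, ?_⟩
  · have h1 := Nat.div_add_mod n D
    have h2 := Nat.mod_lt n hD
    rw [mul_add]
    omega
  · have := Nat.div_le_self n D
    omega

open Finset in
theorem exists_two_valued_sum {k j : ℕ} (hj : j ≤ k) (p q : ℕ) :
    ∃ c : Fin k → ℕ, (∀ i, c i = p ∨ c i = q) ∧ ∑ i, c i = p * j + q * (k - j) := by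
  refine ⟨fun i => if (i : ℕ) < j then p else q, fun i => ?_, ?_⟩
  · dsimp only
    split_ifs <;> simp
  · rw [Fin.sum_univ_eq_sum_range (fun i => if i < j then p else q)]
    obtain ⟨e, rfl⟩ := Nat.exists_eq_add_of_le hj
    rw [sum_range_add, sum_congr rfl (fun i hi => if_pos (mem_range.1 hi))]
    simp [mul_comm]

open Finset in
/-- The value of a polymorphism at columns of prescribed block weights is not constant, provided
these block weights are realised by rows of weight `t` together with `s` copies of `x`. -/
theorem not_constant_of_polymorphism {k t d Q s : ℕ} (ht : 1 < t) (htk : t < k) (hdt : d < t)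
    (x : Fin k → Bool) (hx : wt x = d) {f : (Fin (2 * (k * Q) + 1) → Bool) → Bool}
    (hf : TwoBlockSym f) (hpol : IsPolymorphism (InT k t ∪ {x}) (NAE k) f)
    (hsQ : s ≤ Q) (hQ : 2 ≤ Q) (c : Fin k → ℕ) (hc : ∀ i, c i ≤ 2)
    (hsum : ∑ i, c i + t = (t - d) * s) (β : Bool)
    (hβ : ∀ i, f (interleave (k * Q) (fun l => decide (l < t * Q - c i))
      (fun l => decide (l < t * Q))) = β) : False := by
  have htQ : 2 * Q ≤ t * Q := Nat.mul_le_mul_right _ ht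
  have hkQ : t * Q + Q ≤ k * Q := by
    rw [← Nat.succ_mul]
    exact Nat.mul_le_mul_right _ htk
  obtain ⟨B, hB, hBcol⟩ := exists_rows_of_column_sums_s10 (t := t) (k * Q)
    (fun _ : Fin k => t * Q) (fun _ => by omega) (by simp; ring) htk.le
  have hdecomp : ∀ i, (t * Q - c i - (if x i = true then s else 0)) +
      (if x i = true then s else 0) + c i = t * Q := by
    intro i
    have := hc i
    split_ifs <;> omega
  obtain ⟨A, hA, hAcol⟩ := exists_rows_of_column_sums_s10 (t := t) (k * Q + 1 - s)
    (fun i => t * Q - c i - if x i = true then s else 0)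
    (fun i => by omega) (by
      have h := sum_congr rfl (fun i (_ : i ∈ univ) => hdecomp i)
      rw [sum_add_distrib, sum_add_distrib, ← sum_filter, sum_const, sum_const] at h
      change _ + wt x • s + _ = _ at h
      rw [hx] at h
      simp only [card_univ, Fintype.card_fin, smul_eq_mul] at h
      obtain ⟨e, rfl⟩ := Nat.exists_eq_add_of_le hdt.le
      rw [Nat.add_sub_cancel_left] at hsum
      obtain ⟨n, hn⟩ := Nat.exists_eq_add_of_le (show s ≤ k * Q + 1 by omega)
      rw [hn, Nat.add_sub_cancel_left]
      have hn' : (d + e) * (k * Q + 1) = (d + e) * (s + n) := by rw [hn]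
      nlinarith) htk.le
  have hx_or : ∀ l, (if l < s then x else A (l - s)) ∈ InT k t ∪ {x} := by
    intro l
    split_ifs
    · exact Or.inr rfl
    · exact Or.inl (hA _)
  have hmem := hpol
    (fun j => if (j : ℕ) % 2 = 0 then (if (j : ℕ) / 2 < s then x else A (j / 2 - s))
      else B (j / 2))
    (fun j => by
      by_cases h : (j : ℕ) % 2 = 0
      · rw [if_pos h]
        exact hx_or _
      · rw [if_neg h]
        exact Or.inl (hB _))
  have hval : (fun i => f (fun j : Fin (2 * (k * Q) + 1) =>
      (if (j : ℕ) % 2 = 0 then (if (j : ℕ) / 2 < s then x else A (j / 2 - s))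
        else B (j / 2)) i)) = fun _ => β := by
    funext i
    rw [← hβ i]
    have hrow : (fun j : Fin (2 * (k * Q) + 1) =>
        (if (j : ℕ) % 2 = 0 then (if (j : ℕ) / 2 < s then x else A (j / 2 - s))
          else B (j / 2)) i) =
        interleave (k * Q) (fun l => (if l < s then x else A (l - s)) i) (fun l => B l i) := by
      funext j
      simp only [interleave]
      split_ifs <;> rfl
    rw [hrow]
    refine hf.interleave_congr _ _ _ _ ?_ ?_
    · rw [sum_range_decide_lt (by omega)]
      have hsplit : k * Q + 1 = s + (k * Q + 1 - s) := by omega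
      rw [hsplit, sum_range_add]
      have h1 : ∑ l ∈ range s, (if (if l < s then x else A (l - s)) i = true then 1 else 0)
          = if x i = true then s else 0 := by
        rw [sum_congr rfl (fun l hl => by rw [if_pos (mem_range.1 hl)])]
        simp
      have h2 : ∑ l ∈ range (k * Q + 1 - s),
          (if (if s + l < s then x else A (s + l - s)) i = true then 1 else 0)
          = t * Q - c i - if x i = true then s else 0 := by
        rw [← hAcol i]
        refine sum_congr rfl fun l _ => ?_
        simp
      rw [h1, h2]
      have := hdecomp i
      omega
    · rw [sum_range_decide_lt (by omega)]
      exact hBcol i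
  rw [hval] at hmem
  cases β
  · exact hmem.1 rfl
  · exact hmem.2 rfl

theorem stmt_10 {k t d : ℕ} (hk : 3 ≤ k) (hkodd : Odd k)
    (ht : 1 < t) (htk : t < k) (hteven : Even t)
    (hd1 : 1 ≤ d) (hdt : d < t) (hdeven : Even d) (hsum : t + d ≤ k)
    (x : Fin k → Bool) (hx : wt x = d) :
    ∃ m : ℕ, Odd m ∧ 1 ≤ m ∧ ∀ f : (Fin m → Bool) → Bool,
      TwoBlockSym f → ¬ IsPolymorphism (InT k t ∪ {x}) (NAE k) f := by
  obtain ⟨Q, hQ⟩ : ∃ Q, Q = t + k + 1 := ⟨_, rfl⟩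
  refine ⟨2 * (k * Q) + 1, ⟨_, rfl⟩, by omega, fun f hf hpol => ?_⟩
  let F : ℕ → Bool := fun c => f (interleave (k * Q) (fun l => decide (l < t * Q - c))
    (fun l => decide (l < t * Q)))
  have key : ∀ p q s j : ℕ, p ≤ 2 → q ≤ 2 → j ≤ k → s ≤ Q →
      p * j + q * (k - j) + t = (t - d) * s → F p ≠ F q := by
    intro p q s j hp hq hj hs h hF
    obtain ⟨c, hc, hcsum⟩ := exists_two_valued_sum hj p q
    refine not_constant_of_polymorphism ht htk hdt x hx hf hpol hs (by omega) c
      (fun i => by rcases hc i with h | h <;> omega) (by rw [hcsum, h]) (F q) (fun i => ?_)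
    change F (c i) = F q
    rcases hc i with h | h <;> rw [h]
    exact hF
  obtain ⟨s₁, j₁, h₁, hj₁, hs₁⟩ := exists_mul_eq_add (t - d) t (by omega)
  obtain ⟨s₂, j₂, h₂, hj₂, hs₂⟩ := exists_mul_eq_add (t - d) (t + k) (by omega)
  have hj₁even : Even j₁ := by
    have h : Even (t + j₁) := h₁ ▸ (hteven.tsub hdeven).mul_right s₁
    exact (Nat.even_add.1 h).1 hteven
  obtain ⟨i₁, hi₁⟩ := hj₁even
  have h10 : F 1 ≠ F 0 := key 1 0 s₁ j₁ (by omega) (by omega) (by omega) (by omega) (by omega)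
  have h20 : F 2 ≠ F 0 := key 2 0 s₁ i₁ (by omega) (by omega) (by omega) (by omega) (by omega)
  have h21 : F 2 ≠ F 1 := key 2 1 s₂ j₂ (by omega) (by omega) (by omega) (by omega) (by omega)
  revert h10 h20 h21
  cases F 0 <;> cases F 1 <;> cases F 2 <;> simp
end

section
/- Let k ≥ 3 and 2 ≤ t < k. Then every k-tuple in {0,1}^k of Hamming weight t + 1 is the componentwise majority MAJ_3 of three k-tuples each of Hamming weight exactly t. In symbols, In_{t+1}^k ⊆ MAJ_3(In_t^k). -/
theorem wt_update_false {k : ℕ} {z : Fin k → Bool} {a : Fin k} (ha : z a = true) :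
    wt (Function.update z a false) = wt z - 1 := by
  have h : (Finset.univ.filter fun i => Function.update z a false i = true) =
      (Finset.univ.filter fun i => z i = true).erase a := by
    ext i
    by_cases hi : i = a <;> simp [Function.update_apply, hi]
  rw [wt, h, Finset.card_erase_of_mem (by simpa using ha), wt]

theorem stmt_13 {k t : ℕ} (hk : 3 ≤ k) (ht : 2 ≤ t) (htk : t < k)
    (z : Fin k → Bool) (hz : wt z = t + 1) :
    ∃ u v w : Fin k → Bool, wt u = t ∧ wt v = t ∧ wt w = t ∧
      z = fun i => (u i && v i) || (u i && w i) || (v i && w i) := by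
  obtain ⟨a, b, c, ha, hb, hc, hab, hac, hbc⟩ :=
    Finset.two_lt_card_iff.mp (show 2 < wt z by omega)
  simp only [Finset.mem_filter, Finset.mem_univ, true_and] at ha hb hc
  refine ⟨Function.update z a false, Function.update z b false, Function.update z c false,
    by rw [wt_update_false ha]; omega, by rw [wt_update_false hb]; omega,
    by rw [wt_update_false hc]; omega, ?_⟩
  funext i
  simp only [Function.update_apply]
  cases hi : z i <;> grind
end

section
/- Let k ≥ 3 and let t be even with 2 ≤ t < k. Then every k-tuple in {0,1}^k of Hamming weight t − 2 is the componentwise XOR (mod-2 sum) of three k-tuples each of Hamming weight exactly t. In symbols, In_{t−2}^k ⊆ XOR_3(In_t^k). -/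
theorem wt_decide_mem {k : ℕ} (s : Finset (Fin k)) : wt (fun i => decide (i ∈ s)) = s.card := by
  simp [wt]

theorem stmt_15 {k t : ℕ} (hk : 3 ≤ k) (hteven : Even t) (ht : 2 ≤ t) (htk : t < k)
    (z : Fin k → Bool) (hz : wt z = t - 2) :
    ∃ u v w : Fin k → Bool, wt u = t ∧ wt v = t ∧ wt w = t ∧
      z = fun i => xor (u i) (xor (v i) (w i)) := by
  obtain ⟨s, rfl⟩ : ∃ s : Finset (Fin k), z = fun i => decide (i ∈ s) :=
    ⟨Finset.univ.filter (fun i => z i = true), by simp⟩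
  rw [wt_decide_mem] at hz
  have hcard : 2 < sᶜ.card := by
    rw [Finset.card_compl, Fintype.card_fin]
    omega
  obtain ⟨a, b, c, ha, hb, hc, hab, hac, hbc⟩ := Finset.two_lt_card_iff.mp hcard
  rw [Finset.mem_compl] at ha hb hc
  have card_insert_pair : ∀ x y, x ∉ s → y ∉ s → x ≠ y → (insert x (insert y s)).card = t := by
    intro x y hx hy hxy
    rw [Finset.card_insert_of_notMem (by simp [hxy, hx]), Finset.card_insert_of_notMem hy, hz]
    omega
  refine ⟨fun i => decide (i ∈ insert a (insert b s)), fun i => decide (i ∈ insert a (insert c s)),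
    fun i => decide (i ∈ insert b (insert c s)), ?_, ?_, ?_, ?_⟩
  · rw [wt_decide_mem, card_insert_pair a b ha hb hab]
  · rw [wt_decide_mem, card_insert_pair a c ha hc hac]
  · rw [wt_decide_mem, card_insert_pair b c hb hc hbc]
  · funext i
    simp only [Finset.mem_insert]
    by_cases hia : i = a
    · subst hia; simp [ha, hab, hac]
    by_cases hib : i = b
    · subst hib; simp [hb, hia, hbc]
    by_cases hic : i = c
    · subst hic; simp [hc, hia, hib]
    simp [hia, hib, hic]
end

section
/- Let k ≥ 3 and 1 ≤ t < k, and suppose that t and k are both odd. Then every k-tuple in {0,1}^k of Hamming weight t + 2 is the componentwise XOR (mod-2 sum) of three k-tuples each of Hamming weight exactly t. In symbols, In_{t+2}^k ⊆ XOR_3(In_t^k). -/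
/-- Clearing two coordinates set to `true` lowers the Hamming weight by two. -/
theorem wt_update_update_false {k : ℕ} (z : Fin k → Bool) {a b : Fin k} (hab : a ≠ b)
    (ha : z a = true) (hb : z b = true) :
    wt (Function.update (Function.update z a false) b false) + 2 = wt z := by
  have h : (Finset.univ.filter fun i =>
      Function.update (Function.update z a false) b false i = true) =
      ((Finset.univ.filter fun i => z i = true).erase a).erase b := by
    ext i
    by_cases hia : i = a <;> by_cases hib : i = b <;> simp [Function.update_apply, hia, hib]
  have hb' : b ∈ (Finset.univ.filter fun i => z i = true).erase a := by
    simp [hab.symm, hb]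
  have ha' : a ∈ Finset.univ.filter fun i => z i = true := by
    simp [ha]
  unfold wt
  rw [h, ← Finset.card_erase_add_one ha', ← Finset.card_erase_add_one hb']

theorem stmt_16 {k t : ℕ} (hk : 3 ≤ k) (ht : 1 ≤ t) (htk : t < k)
    (htodd : Odd t) (hkodd : Odd k)
    (z : Fin k → Bool) (hz : wt z = t + 2) :
    ∃ u v w : Fin k → Bool, wt u = t ∧ wt v = t ∧ wt w = t ∧
      z = fun i => xor (u i) (xor (v i) (w i)) := by
  obtain ⟨a, b, c, ha, hb, hc, hab, hac, hbc⟩ :=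
    Finset.two_lt_card_iff.1 (show 2 < (Finset.univ.filter fun i => z i = true).card by
      change 2 < wt z
      omega)
  simp only [Finset.mem_filter, Finset.mem_univ, true_and] at ha hb hc
  have h₁ := wt_update_update_false z hab ha hb
  have h₂ := wt_update_update_false z hac ha hc
  have h₃ := wt_update_update_false z hbc hb hc
  rw [hz] at h₁ h₂ h₃
  refine ⟨_, _, _, Nat.add_right_cancel h₁, Nat.add_right_cancel h₂, Nat.add_right_cancel h₃, ?_⟩
  funext i
  simp only [Function.update_apply]
  by_cases hia : i = a <;> by_cases hib : i = b <;> by_cases hic : i = c <;> simp_all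
end

section
/- Let k ≥ 4 be even and let t be even with 2 ≤ t < k. Then there exist k − 1 tuples v_1, …, v_{k−1} ∈ {0,1}^k, each of Hamming weight exactly t, whose componentwise mod-2 sum is the all-ones tuple: for every coordinate i, (v_1)_i + ⋯ + (v_{k−1})_i ≡ 1 (mod 2). -/
/-- An initial segment of `Fin n` pulled back along a bijection keeps its cardinality. -/
theorem card_filter_equiv_val_lt {n s : ℕ} (hs : s ≤ n) (e : Fin n ≃ Fin n) :
    (Finset.univ.filter (fun x : Fin n => (e x : ℕ) < s)).card = s := by
  have h : (Finset.univ.filter (fun x : Fin n => (e x : ℕ) < s)).card =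
      (Finset.univ.filter (fun x : Fin n => (x : ℕ) < s)).card :=
    Finset.card_equiv e (by simp)
  rw [h, Fin.card_filter_val_lt, min_eq_right hs]

/-- The tuples are the cyclic shifts of a block of `t - 1` ones on `k - 1` coordinates, each
extended by a one in the remaining coordinate. -/
theorem stmt_18 {k t : ℕ} (hk : 4 ≤ k) (hkeven : Even k)
    (hteven : Even t) (ht : 2 ≤ t) (htk : t < k) :
    ∃ v : Fin (k - 1) → Fin k → Bool, (∀ j, wt (v j) = t) ∧
      ∀ i : Fin k,
        Odd ((Finset.univ.filter (fun j : Fin (k - 1) => v j i = true)).card) := by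
  obtain ⟨m, rfl⟩ : ∃ m, k = m + 2 := ⟨k - 2, by omega⟩
  obtain ⟨s, rfl⟩ : ∃ s, t = s + 1 := ⟨t - 1, by omega⟩
  have hs : s ≤ m + 1 := by omega
  change ∃ v : Fin (m + 1) → Fin (m + 2) → Bool, (∀ j, wt (v j) = s + 1) ∧
    ∀ i : Fin (m + 2), Odd ((Finset.univ.filter (fun j : Fin (m + 1) => v j i = true)).card)
  refine ⟨fun j => Fin.cons true (fun x : Fin (m + 1) => decide (((x - j : Fin (m + 1)) : ℕ) < s)),
    fun j => ?_, fun i => ?_⟩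
  · have h := card_filter_equiv_val_lt hs (Equiv.subRight j)
    simp only [Equiv.subRight_apply] at h
    rw [wt, Fin.card_filter_univ_succ]
    simp [h]
  · refine Fin.cases ?_ (fun x => ?_) i
    · simpa using (by grind : Odd (m + 1))
    · have h := card_filter_equiv_val_lt hs (Equiv.subLeft x)
      simp only [Equiv.subLeft_apply] at h
      simp only [Fin.cons_succ, decide_eq_true_eq, h]
      grind
end
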